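/- arXiv:1906.00025 — 6 statements merged into one kernel-verified Lean document; each statement's English description precedes it below -/
import Mathlib

section
/- Let m ≥ 20 be a positive integer. Then ∫_{[0,1]^m} min_{1≤j≤m} (1/4 − θ_j)² dμ_m(θ) ≤ 1.01 / (2(m+1)(m+2)). (This is the paper's Lemma 1: if θ_1,…,θ_m are i.i.d. uniform on [0,1] and m ≥ 20, then E[min_j (1/4 − θ_j)²] ≤ 1.01/(2(m+1)(m+2)).) -/
open MeasureTheory

theorem sq_iInf_abs {ι : Type*} [Finite ι] [Nonempty ι] (x : ι → ℝ) :
    (⨅ j, |x j|) ^ 2 = ⨅ j, x j ^ 2 := by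
  have hbdd : BddBelow (Set.range fun j => |x j|) := (Set.finite_range _).bddBelow
  refine le_antisymm (le_ciInf fun j => ?_) ?_
  · rw [← sq_abs (x j)]
    exact pow_le_pow_left₀ (Real.iInf_nonneg fun _ => abs_nonneg _) (ciInf_le hbdd j) 2
  · obtain ⟨j, hj⟩ := exists_eq_ciInf_of_finite (f := fun j => |x j|)
    rw [← hj, sq_abs]
    exact ciInf_le (Set.finite_range fun j => x j ^ 2).bddBelow j

theorem measurable_iInf_abs_sub {ι : Type*} [Countable ι] (c : ℝ) :
    Measurable fun θ : ι → ℝ => ⨅ j, |c - θ j| :=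
  Measurable.iInf fun j => by fun_prop

theorem volume_restrict_pi_setOf_le_iInf {ι : Type*} [Fintype ι] [Nonempty ι] (s : Set ℝ)
    (f : ℝ → ℝ) (t : ℝ) :
    (volume : Measure (ι → ℝ)).restrict (Set.univ.pi fun _ => s) {θ | t ≤ ⨅ j, f (θ j)}
      = (volume.restrict s {x | t ≤ f x}) ^ Fintype.card ι := by
  have h : {θ : ι → ℝ | t ≤ ⨅ j, f (θ j)} = Set.univ.pi fun _ => {x | t ≤ f x} := by
    ext θ
    simp [le_ciInf_iff (Set.finite_range fun j => f (θ j)).bddBelow]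
  rw [h, volume_pi, Measure.restrict_pi_pi, Measure.pi_pi]
  simp

theorem volume_restrict_le_abs_sub_of_le {t : ℝ} (ht : t ≤ 1 / 4) :
    volume.restrict (Set.Icc (0 : ℝ) 1) {x | t ≤ |1 / 4 - x|} ≤ ENNReal.ofReal (1 - 2 * t) := by
  rw [Measure.restrict_apply (measurableSet_le (by fun_prop) (by fun_prop))]
  calc _ ≤ volume (Set.Icc 0 (1 / 4 - t) ∪ Set.Icc (1 / 4 + t) 1) := by
        refine measure_mono ?_
        rintro x ⟨hx, h0, h1⟩
        rcases le_abs.1 (show t ≤ |1 / 4 - x| from hx) with h | h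
        · exact Or.inl ⟨h0, by linarith⟩
        · exact Or.inr ⟨by linarith, h1⟩
    _ ≤ _ := measure_union_le _ _
    _ = _ := by
        rw [Real.volume_Icc, Real.volume_Icc, ← ENNReal.ofReal_add (by linarith) (by linarith)]
        congr 1
        ring

theorem volume_restrict_le_abs_sub_of_lt {t : ℝ} (ht : 1 / 4 < t) :
    volume.restrict (Set.Icc (0 : ℝ) 1) {x | t ≤ |1 / 4 - x|} ≤ ENNReal.ofReal (3 / 4 - t) := by
  rw [Measure.restrict_apply (measurableSet_le (by fun_prop) (by fun_prop))]
  calc _ ≤ volume (Set.Icc (1 / 4 + t) 1) := by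
        refine measure_mono ?_
        rintro x ⟨hx, h0, h1⟩
        rcases le_abs.1 (show t ≤ |1 / 4 - x| from hx) with h | h
        · linarith
        · exact ⟨by linarith, h1⟩
    _ = _ := by
        rw [Real.volume_Icc]
        congr 1
        ring

theorem integral_two_mul_mul_one_sub_two_mul_pow (m : ℕ) :
    ∫ t in (0 : ℝ)..(1 / 2), 2 * t * (1 - 2 * t) ^ m = 1 / (2 * ((m : ℝ) + 1) * ((m : ℝ) + 2)) := by
  have hderiv (t : ℝ) : HasDerivAt (fun t : ℝ => -(1 - 2 * t) ^ (m + 1) / (2 * ((m : ℝ) + 1))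
      + (1 - 2 * t) ^ (m + 2) / (2 * ((m : ℝ) + 2))) (2 * t * (1 - 2 * t) ^ m) t := by
    have h : HasDerivAt (fun t : ℝ => 1 - 2 * t) (-2) t := by
      simpa using ((hasDerivAt_id t).const_mul 2).const_sub 1
    refine (((h.pow (m + 1)).neg.div_const (2 * ((m : ℝ) + 1))).add
      ((h.pow (m + 2)).div_const (2 * ((m : ℝ) + 2)))).congr_deriv ?_
    simp only [show m + 2 - 1 = m + 1 by omega, Nat.add_sub_cancel, pow_succ]
    push_cast
    field_simp
    ring
  rw [intervalIntegral.integral_eq_sub_of_hasDerivAt (fun t _ => hderiv t)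
    (Continuous.intervalIntegrable (by fun_prop) _ _)]
  norm_num
  field_simp
  ring

theorem mul_succ_mul_succ_le_two_pow {m : ℕ} (hm : 20 ≤ m) :
    150 * (m + 1) * (m + 2) ≤ 2 ^ m := by
  induction m, hm using Nat.le_induction with
  | base => norm_num
  | succ n hn ih =>
    rw [pow_succ]
    nlinarith

theorem lintegral_meas_le_iInf_abs_sub_le (m : ℕ) (hm : m ≠ 0) :
    ∫⁻ t in Set.Ioi (0 : ℝ), (volume.restrict (Set.Icc (0 : ℝ) 1) {x | t ≤ |1 / 4 - x|}) ^ m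
        * ENNReal.ofReal (2 * t)
      ≤ ENNReal.ofReal (1 / (2 * ((m : ℝ) + 1) * ((m : ℝ) + 2)) + 3 / 4 * (1 / 2) ^ m) := by
  let f : ℝ → ENNReal := (Set.Ioc 0 (1 / 2)).indicator
    fun t => ENNReal.ofReal (2 * t * (1 - 2 * t) ^ m)
  let g : ℝ → ENNReal := (Set.Ioc (1 / 4) (3 / 4)).indicator
    fun _ => ENNReal.ofReal (3 / 2 * (1 / 2) ^ m)
  have hbound (t : ℝ) (ht : 0 < t) :
      (volume.restrict (Set.Icc (0 : ℝ) 1) {x | t ≤ |1 / 4 - x|}) ^ m * ENNReal.ofReal (2 * t)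
        ≤ f t + g t := by
    rcases le_or_gt t (1 / 4) with h | h
    · refine le_add_right ?_
      simp only [f]
      rw [Set.indicator_of_mem (Set.mem_Ioc.2 ⟨ht, by linarith⟩), mul_comm,
        ENNReal.ofReal_mul (p := 2 * t) (by linarith), ENNReal.ofReal_pow (by linarith)]
      gcongr
      exact volume_restrict_le_abs_sub_of_le h
    rcases le_or_gt t (3 / 4) with h' | h'
    · refine le_add_left ?_
      simp only [g]
      rw [Set.indicator_of_mem (Set.mem_Ioc.2 ⟨h, h'⟩), mul_comm,
        ENNReal.ofReal_mul (p := 3 / 2) (by norm_num), ENNReal.ofReal_pow (by norm_num)]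
      gcongr
      · linarith
      · exact (volume_restrict_le_abs_sub_of_lt h).trans (ENNReal.ofReal_le_ofReal (by linarith))
    · have h0 := volume_restrict_le_abs_sub_of_lt h
      rw [ENNReal.ofReal_of_nonpos (by linarith), nonpos_iff_eq_zero] at h0
      rw [h0, zero_pow hm, zero_mul]
      exact zero_le
  have hf : ∫⁻ t, f t = ENNReal.ofReal (1 / (2 * ((m : ℝ) + 1) * ((m : ℝ) + 2))) := by
    rw [lintegral_indicator measurableSet_Ioc, ← integral_two_mul_mul_one_sub_two_mul_pow,
      intervalIntegral.integral_of_le (by norm_num), ofReal_integral_eq_lintegral_ofReal]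
    · exact (Continuous.integrableOn_Icc (by fun_prop)).mono_set Set.Ioc_subset_Icc_self
    · filter_upwards [ae_restrict_mem measurableSet_Ioc] with t ht
      have := ht.1
      exact mul_nonneg (by linarith) (pow_nonneg (by linarith [ht.2]) _)
  have hg : ∫⁻ t, g t = ENNReal.ofReal (3 / 4 * (1 / 2) ^ m) := by
    rw [lintegral_indicator_const measurableSet_Ioc, Real.volume_Ioc,
      ← ENNReal.ofReal_mul (by positivity)]
    congr 1
    ring
  calc _ ≤ ∫⁻ t in Set.Ioi (0 : ℝ), (f t + g t) := setLIntegral_mono' measurableSet_Ioi hbound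
    _ ≤ ∫⁻ t, (f t + g t) := setLIntegral_le_lintegral _ _
    _ = _ := by
      rw [lintegral_add_right _ (measurable_const.indicator measurableSet_Ioc), hf, hg,
        ← ENNReal.ofReal_add (by positivity) (by positivity)]

/-- Lemma 1: if `θ_1, …, θ_m` are i.i.d. uniform on `[0,1]` and `m ≥ 20`, then
`E[min_j (1/4 − θ_j)²] ≤ 1.01 / (2(m+1)(m+2))`. The uniform probability measure on the cube
`[0,1]^m` is Lebesgue measure restricted to the cube. -/
theorem min_margin_lemma1 (m : ℕ) (hm : 20 ≤ m) :
    ∫ θ : Fin m → ℝ, (⨅ j : Fin m, ((1 / 4 : ℝ) - θ j) ^ 2)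
        ∂(volume.restrict (Set.univ.pi fun _ : Fin m => Set.Icc (0 : ℝ) 1))
      ≤ 1.01 / (2 * ((m : ℝ) + 1) * ((m : ℝ) + 2)) := by
  have : Nonempty (Fin m) := ⟨⟨0, by omega⟩⟩
  simp_rw [← sq_iInf_abs]
  have hmeas := measurable_iInf_abs_sub (ι := Fin m) (1 / 4)
  rw [integral_eq_lintegral_of_nonneg_ae (ae_of_all _ fun _ => sq_nonneg _)
    (hmeas.pow_const 2).aestronglyMeasurable]
  refine ENNReal.toReal_le_of_le_ofReal (by positivity) ?_
  have hlayer := lintegral_comp_eq_lintegral_meas_le_mul (g := fun t => 2 * t)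
    (volume.restrict (Set.univ.pi fun _ : Fin m => Set.Icc (0 : ℝ) 1))
    (ae_of_all _ fun θ => Real.iInf_nonneg fun j => abs_nonneg (1 / 4 - θ j))
    hmeas.aemeasurable (fun t _ => Continuous.intervalIntegrable (by fun_prop) _ _)
    (by filter_upwards [ae_restrict_mem measurableSet_Ioi] with t ht
        exact mul_nonneg zero_le_two (le_of_lt ht))
  have hsq (a : ℝ) : ∫ t in (0 : ℝ)..a, 2 * t = a ^ 2 := by
    rw [intervalIntegral.integral_const_mul, integral_id]
    ring
  simp_rw [hsq, volume_restrict_pi_setOf_le_iInf _ (fun x => |1 / 4 - x|), Fintype.card_fin] at hlayer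
  rw [hlayer]
  refine (lintegral_meas_le_iInf_abs_sub_le m (by omega)).trans (ENNReal.ofReal_le_ofReal ?_)
  have hpow : (150 : ℝ) * (m + 1) * (m + 2) ≤ 2 ^ m := by
    exact_mod_cast mul_succ_mul_succ_le_two_pow hm
  have hsmall : (3 : ℝ) / 4 * (1 / 2) ^ m ≤ 0.01 / (2 * ((m : ℝ) + 1) * ((m : ℝ) + 2)) := by
    rw [one_div_pow, mul_one_div, div_le_div_iff₀ (by positivity) (by positivity)]
    linarith
  calc _ ≤ 1 / (2 * ((m : ℝ) + 1) * ((m : ℝ) + 2))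
          + 0.01 / (2 * ((m : ℝ) + 1) * ((m : ℝ) + 2)) := by
        gcongr
    _ = _ := by
        rw [← add_div]
        norm_num
end

section
/- For every positive integer m, ∫_{[0,1]^m} min_{1≤j≤m} (1/4 − θ_j)² dμ_m(θ) = (1/2 + (2m+10) · 2^{−(m+4)}) / ((m+1)(m+2)). (This is the exact value of the expectation bounded in Lemma 1, obtained as the sum of the two closed-form integrals in its proof, with the corrected numerator.) -/
open MeasureTheory

lemma intervalIntegral_affine_pow_mul (c k a b : ℝ) (hk : k ≠ 0) (m : ℕ) :
    ∫ t in a..b, (c - k * t) ^ m * (2 * t)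
      = 2 / k ^ 2 * ((c * (c - k * a) ^ (m + 1) / (m + 1) - (c - k * a) ^ (m + 2) / (m + 2))
          - (c * (c - k * b) ^ (m + 1) / (m + 1) - (c - k * b) ^ (m + 2) / (m + 2))) := by
  have h1 : (m : ℝ) + 1 ≠ 0 := by positivity
  have h2 : (m : ℝ) + 2 ≠ 0 := by positivity
  rw [intervalIntegral.integral_eq_sub_of_hasDerivAt (f := fun t =>
    -(2 / k ^ 2) * (c * (c - k * t) ^ (m + 1) / (m + 1) - (c - k * t) ^ (m + 2) / (m + 2)))]
  · ring
  · intro t _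
    have hu : HasDerivAt (fun t : ℝ => c - k * t) (-k) t := by
      simpa using ((hasDerivAt_id t).const_mul k).const_sub c
    refine (((((hu.pow (m + 1)).const_mul c).div_const ((m : ℝ) + 1)).sub
      ((hu.pow (m + 2)).div_const ((m : ℝ) + 2))).const_mul (-(2 / k ^ 2))).congr_deriv ?_
    push_cast [Nat.add_sub_cancel, show m + 2 - 1 = m + 1 by omega]
    field_simp
    ring
  · exact (by fun_prop : Continuous fun t : ℝ => (c - k * t) ^ m * (2 * t)).intervalIntegrable _ _

lemma volume_Icc_inter_lt_abs_quarter_sub {t : ℝ} (ht : 0 < t) :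
    volume (Set.Icc (0 : ℝ) 1 ∩ {x | t < |1 / 4 - x|})
      = ENNReal.ofReal (max (1 / 4 - t) 0 + max (3 / 4 - t) 0) := by
  have hset : Set.Icc (0 : ℝ) 1 ∩ {x | t < |1 / 4 - x|}
      = Set.Ico 0 (1 / 4 - t) ∪ Set.Ioc (1 / 4 + t) 1 := by
    ext x
    simp only [Set.mem_inter_iff, Set.mem_Icc, Set.mem_ofPred_eq, Set.mem_union, Set.mem_Ico,
      Set.mem_Ioc, lt_abs]
    grind
  have hdisj : Disjoint (Set.Ico 0 (1 / 4 - t)) (Set.Ioc (1 / 4 + t) 1) := by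
    rw [Set.disjoint_left]
    intro x hx hx'
    linarith [hx.2, hx'.1]
  rw [hset, measure_union hdisj measurableSet_Ioc, Real.volume_Ico, Real.volume_Ioc,
    ENNReal.ofReal_add (le_max_right _ _) (le_max_right _ _), ENNReal.ofReal_max,
    ENNReal.ofReal_max, ENNReal.ofReal_zero, max_eq_left zero_le, max_eq_left zero_le]
  congr 2 <;> ring

lemma restrict_cube_lt_sqrt_iInf_sq {m : ℕ} (hm : 0 < m) {t : ℝ} (ht : 0 < t) :
    (volume.restrict (Set.univ.pi fun _ : Fin m => Set.Icc (0 : ℝ) 1))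
        {θ : Fin m → ℝ | t < √(⨅ j : Fin m, ((1 / 4 : ℝ) - θ j) ^ 2)}
      = ENNReal.ofReal ((max (1 / 4 - t) 0 + max (3 / 4 - t) 0) ^ m) := by
  have : Nonempty (Fin m) := ⟨⟨0, hm⟩⟩
  have hset : {θ : Fin m → ℝ | t < √(⨅ j : Fin m, ((1 / 4 : ℝ) - θ j) ^ 2)}
      = Set.univ.pi fun _ : Fin m => {x | t < |1 / 4 - x|} := by
    ext θ
    simp only [Set.mem_ofPred_eq, Set.mem_univ_pi]
    rw [Real.lt_sqrt ht.le, iInf, (Set.finite_range _).lt_csInf_iff (Set.range_nonempty _),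
      Set.forall_mem_range]
    refine forall_congr' fun j => ?_
    rw [sq_lt_sq, abs_of_pos ht]
  have hmeas : MeasurableSet {x : ℝ | t < |1 / 4 - x|} :=
    measurableSet_lt (by fun_prop) (by fun_prop)
  rw [hset, Measure.restrict_apply (MeasurableSet.univ_pi fun _ => hmeas), Set.inter_comm,
    ← Set.pi_inter_distrib, volume_pi_pi]
  simp only [volume_Icc_inter_lt_abs_quarter_sub ht, Finset.prod_const, Finset.card_univ,
    Fintype.card_fin]
  rw [ENNReal.ofReal_pow (by positivity)]

lemma integral_eq_integral_meas_lt_sqrt_mul {α : Type*} [MeasurableSpace α] (μ : Measure α)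
    [IsFiniteMeasure μ] {f : α → ℝ} (hf : Measurable f) (hf0 : ∀ x, 0 ≤ f x) :
    ∫ x, f x ∂μ = ∫ t in Set.Ioi (0 : ℝ), μ.real {x | t < √(f x)} * (2 * t) := by
  have hanti : Antitone fun t : ℝ => μ.real {x | t < √(f x)} :=
    fun s t hst => measureReal_mono fun x (hx : t < √(f x)) => hst.trans_lt hx
  have hmeas : Measurable fun t : ℝ => μ.real {x | t < √(f x)} * (2 * t) :=
    hanti.measurable.mul (measurable_id.const_mul 2)
  have hsqrt : Measurable fun x => √(f x) := Real.continuous_sqrt.measurable.comp hf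
  rw [integral_eq_lintegral_of_nonneg_ae (.of_forall hf0) hf.aestronglyMeasurable,
    integral_eq_lintegral_of_nonneg_ae _ hmeas.aestronglyMeasurable]
  · congr 1
    have hcake := lintegral_comp_eq_lintegral_meas_lt_mul μ (g := fun t => 2 * t)
      (.of_forall fun x => Real.sqrt_nonneg (f x)) hsqrt.aemeasurable
      (fun t _ => (continuous_const.mul continuous_id).intervalIntegrable _ _)
      ((ae_restrict_mem measurableSet_Ioi).mono fun t (ht : 0 < t) => by positivity)
    have hsq (x : α) : ∫ t in (0 : ℝ)..√(f x), 2 * t = f x := by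
      rw [intervalIntegral.integral_const_mul, integral_id, Real.sq_sqrt (hf0 x)]
      ring
    simp only [hsq] at hcake
    rw [hcake]
    refine lintegral_congr fun t => ?_
    rw [ENNReal.ofReal_mul measureReal_nonneg, ofReal_measureReal]
  · exact (ae_restrict_mem measurableSet_Ioi).mono fun t (ht : 0 < t) =>
      mul_nonneg measureReal_nonneg (by positivity)

lemma integral_cube_iInf_sq_eq_integral_tail {m : ℕ} (hm : 0 < m) :
    ∫ θ : Fin m → ℝ, (⨅ j : Fin m, ((1 / 4 : ℝ) - θ j) ^ 2)
        ∂(volume.restrict (Set.univ.pi fun _ : Fin m => Set.Icc (0 : ℝ) 1))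
      = ∫ t in Set.Ioi (0 : ℝ), (max (1 / 4 - t) 0 + max (3 / 4 - t) 0) ^ m * (2 * t) := by
  have : IsFiniteMeasure
      (volume.restrict (Set.univ.pi fun _ : Fin m => Set.Icc (0 : ℝ) 1)) :=
    isFiniteMeasure_restrict.2 (isCompact_univ_pi fun _ => isCompact_Icc).measure_ne_top
  rw [integral_eq_integral_meas_lt_sqrt_mul _ (.iInf fun j => by fun_prop)
    fun θ => Real.iInf_nonneg fun j => sq_nonneg _]
  refine setIntegral_congr_fun measurableSet_Ioi fun t (ht : 0 < t) => ?_
  rw [measureReal_def, restrict_cube_lt_sqrt_iInf_sq hm ht, ENNReal.toReal_ofReal (by positivity)]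

/-- The exact value of the expectation bounded in Lemma 1: for `θ_1, …, θ_m` i.i.d. uniform on
`[0,1]`, `E[min_j (1/4 − θ_j)²] = (1/2 + (2m+10)·2^{−(m+4)}) / ((m+1)(m+2))`. -/
theorem min_sq_dist_quarter_expectation (m : ℕ) (hm : 0 < m) :
    ∫ θ : Fin m → ℝ, (⨅ j : Fin m, ((1 / 4 : ℝ) - θ j) ^ 2)
        ∂(volume.restrict (Set.univ.pi fun _ : Fin m => Set.Icc (0 : ℝ) 1))
      = (1 / 2 + (2 * (m : ℝ) + 10) * ((2 : ℝ) ^ (m + 4))⁻¹)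
          / (((m : ℝ) + 1) * ((m : ℝ) + 2)) := by
  have hcont : Continuous fun t : ℝ =>
      (max (1 / 4 - t) 0 + max (3 / 4 - t) 0) ^ m * (2 * t) := by fun_prop
  have hnear : ∫ t in (0 : ℝ)..1 / 4, (max (1 / 4 - t) 0 + max (3 / 4 - t) 0) ^ m * (2 * t)
      = ∫ t in (0 : ℝ)..1 / 4, (1 - 2 * t) ^ m * (2 * t) := by
    refine intervalIntegral.integral_congr fun t ht => ?_
    rw [Set.uIcc_of_le (by norm_num)] at ht
    rw [max_eq_left (by linarith [ht.2]), max_eq_left (by linarith [ht.2])]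
    ring
  have hfar : ∫ t in (1 / 4 : ℝ)..3 / 4, (max (1 / 4 - t) 0 + max (3 / 4 - t) 0) ^ m * (2 * t)
      = ∫ t in (1 / 4 : ℝ)..3 / 4, (3 / 4 - 1 * t) ^ m * (2 * t) := by
    refine intervalIntegral.integral_congr fun t ht => ?_
    rw [Set.uIcc_of_le (by norm_num)] at ht
    rw [max_eq_right (by linarith [ht.1]), max_eq_left (by linarith [ht.2])]
    ring
  rw [integral_cube_iInf_sq_eq_integral_tail hm,
    setIntegral_eq_of_subset_of_forall_sdiff_eq_zero measurableSet_Ioi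
      (Set.Ioc_subset_Ioi_self : Set.Ioc (0 : ℝ) (3 / 4) ⊆ _),
    ← intervalIntegral.integral_of_le (by norm_num),
    ← intervalIntegral.integral_add_adjacent_intervals (b := 1 / 4)
      (hcont.intervalIntegrable _ _) (hcont.intervalIntegrable _ _),
    hnear, hfar, intervalIntegral_affine_pow_mul _ _ _ _ two_ne_zero,
    intervalIntegral_affine_pow_mul _ _ _ _ one_ne_zero]
  · have h1 : (m : ℝ) + 1 ≠ 0 := by positivity
    have h2 : (m : ℝ) + 2 ≠ 0 := by positivity
    norm_num [pow_succ, div_pow]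
    field_simp
    ring
  · rintro t ⟨ht, ht'⟩
    have : 3 / 4 < t := by
      by_contra! h
      exact ht' ⟨ht, h⟩
    rw [max_eq_right (by linarith), max_eq_right (by linarith)]
    simp [hm.ne']
end

section
/- Let m ≥ 100 be an integer, let θ and θ̃ be independent, each uniformly distributed on [0, π/2]^m, and let X(θ) denote the ⌊m/2⌋-th smallest coordinate of θ. Then E[ min_{1≤j≤m} ((X(θ) − θ̃_j)/2)² ] ≤ 5 π² / (64 (m+1)(m+2)). (This is the displayed intermediate bound in the proof of Theorem 1, obtained by conditioning on whether |X(θ) − π/4| ≤ π/8 and applying Lemma 1 and the Chebyshev bound.) -/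
open MeasureTheory Real

/-- The uniform probability measure on `[0, π/2]`. -/
noncomputable def uniformAngle : Measure ℝ :=
  ENNReal.ofReal (2 / π) • volume.restrict (Set.Icc (0 : ℝ) (π / 2))

lemma uniformAngle_apply_of_inter_subset {s t : Set ℝ} (hs : MeasurableSet s)
    (h : s ∩ Set.Icc 0 (π / 2) ⊆ t) :
    uniformAngle s ≤ ENNReal.ofReal (2 / π) * volume t := by
  rw [uniformAngle, Measure.smul_apply, Measure.restrict_apply hs, smul_eq_mul]
  gcongr

instance : IsProbabilityMeasure uniformAngle := by
  constructor
  rw [uniformAngle, Measure.smul_apply, Measure.restrict_apply_univ, Real.volume_Icc, smul_eq_mul,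
    ← ENNReal.ofReal_mul (by positivity), sub_zero]
  have := pi_pos
  rw [show 2 / π * (π / 2) = 1 by field_simp, ENNReal.ofReal_one]

lemma pi_uniformAngle (m : ℕ) :
    ENNReal.ofReal ((2 / π) ^ m) •
      volume.restrict (Set.univ.pi fun _ : Fin m => Set.Icc (0 : ℝ) (π / 2)) =
    Measure.pi fun _ : Fin m => uniformAngle := by
  symm
  refine Measure.pi_eq fun s hs => ?_
  rw [volume_pi, Measure.restrict_pi_pi, Measure.smul_apply, Measure.pi_pi]
  simp only [uniformAngle, Measure.smul_apply, smul_eq_mul, Finset.prod_mul_distrib,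
    Finset.prod_const, Finset.card_univ, Fintype.card_fin]
  rw [ENNReal.ofReal_pow (by positivity)]

/-- The length of the part of `[0, 1]` at distance more than `t` from `u`. -/
noncomputable def farLength (u t : ℝ) : ℝ := max (u - t) 0 + max (1 - u - t) 0

lemma farLength_nonneg (u t : ℝ) : 0 ≤ farLength u t := by
  unfold farLength; positivity

lemma uniformAngle_far_le (u t : ℝ) :
    uniformAngle {v | t < |π / 2 * u - v| / (π / 2)} ≤ ENNReal.ofReal (farLength u t) := by
  have hpi := pi_pos
  have hmeas : MeasurableSet {v | t < |π / 2 * u - v| / (π / 2)} :=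
    measurableSet_lt measurable_const (by fun_prop)
  refine (uniformAngle_apply_of_inter_subset hmeas (t := Set.Icc 0 (π / 2 * (u - t)) ∪
    Set.Icc (π / 2 * (u + t)) (π / 2)) ?_).trans ?_
  · rintro v ⟨hv, hv0, hv1⟩
    rw [Set.mem_ofPred_eq, lt_div_iff₀ (by positivity), lt_abs] at hv
    rcases hv with hv | hv
    · left; constructor <;> nlinarith
    · right; constructor <;> nlinarith
  · calc _ ≤ ENNReal.ofReal (2 / π) * (ENNReal.ofReal (π / 2 * (u - t) - 0) +
            ENNReal.ofReal (π / 2 - π / 2 * (u + t))) := by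
          gcongr
          refine (measure_union_le _ _).trans ?_
          rw [Real.volume_Icc, Real.volume_Icc]
      _ = ENNReal.ofReal (u - t) + ENNReal.ofReal (1 - u - t) := by
          rw [mul_add, ← ENNReal.ofReal_mul (by positivity), ← ENNReal.ofReal_mul (by positivity)]
          congr 2 <;> field_simp <;> ring
      _ = _ := by
          rw [farLength, ENNReal.ofReal_add (by positivity) (by positivity)]
          simp

lemma integral_one_sub_mul_pow {a : ℝ} (ha : 0 < a) (m : ℕ) :
    ∫ t in (0 : ℝ)..1 / a, (1 - a * t) ^ m * t = 1 / (a ^ 2 * ((m + 1) * (m + 2))) := by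
  have hd : ∀ t ∈ Set.uIcc (0 : ℝ) (1 / a), HasDerivAt
      (fun t => ((1 - a * t) ^ (m + 2) / (m + 2) - (1 - a * t) ^ (m + 1) / (m + 1)) / a ^ 2)
      ((1 - a * t) ^ m * t) t := by
    intro t _
    have h1 : HasDerivAt (fun t => 1 - a * t) (-a) t := by
      simpa using ((hasDerivAt_id t).const_mul a).const_sub 1
    have h2 := (((h1.pow (m + 2)).div_const ((m : ℝ) + 2)).sub
      ((h1.pow (m + 1)).div_const ((m : ℝ) + 1))).div_const (a ^ 2)
    refine h2.congr_deriv ?_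
    have : (m : ℝ) + 1 ≠ 0 := by positivity
    have : (m : ℝ) + 2 ≠ 0 := by positivity
    push_cast
    field_simp
    ring
  rw [intervalIntegral.integral_eq_sub_of_hasDerivAt hd
    (Continuous.intervalIntegrable (by fun_prop) _ _)]
  have : (m : ℝ) + 1 ≠ 0 := by positivity
  have : (m : ℝ) + 2 ≠ 0 := by positivity
  rw [mul_one_div_cancel ha.ne']
  simp
  field_simp
  ring

lemma integral_max_one_sub_mul_pow {a : ℝ} (ha : 1 ≤ a) {m : ℕ} (hm : m ≠ 0) :
    ∫ t in (0 : ℝ)..1, max (1 - a * t) 0 ^ m * t = 1 / (a ^ 2 * ((m + 1) * (m + 2))) := by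
  have ha0 : 0 < a := by linarith
  have hle : 1 / a ≤ 1 := by rw [div_le_one ha0]; exact ha
  have hpos : 0 ≤ 1 / a := by positivity
  have hi : ∀ x y : ℝ, IntervalIntegrable (fun t => max (1 - a * t) 0 ^ m * t) volume x y :=
    fun x y => Continuous.intervalIntegrable (by fun_prop) _ _
  rw [← intervalIntegral.integral_add_adjacent_intervals (hi 0 (1 / a)) (hi (1 / a) 1),
    ← integral_one_sub_mul_pow ha0 m]
  have h0 : ∫ t in (1 / a)..1, max (1 - a * t) 0 ^ m * t = 0 := by
    refine intervalIntegral.integral_zero_ae (Filter.Eventually.of_forall fun t ht => ?_)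
    rw [Set.uIoc_of_le hle] at ht
    have : 1 ≤ a * t := by
      have := (div_lt_iff₀ ha0).1 ht.1
      linarith
    rw [max_eq_right (by linarith), zero_pow hm, zero_mul]
  rw [h0, add_zero]
  refine intervalIntegral.integral_congr fun t ht => ?_
  rw [Set.uIcc_of_le hpos] at ht
  have : a * t ≤ 1 := by
    have := (le_div_iff₀ ha0).1 ht.2
    linarith
  rw [max_eq_left (by linarith)]

lemma lintegral_farLength_pow_le {u a : ℝ} (hu : u ∈ Set.Icc (0 : ℝ) 1) (ha : 1 ≤ a)
    (h : ∀ t, 0 ≤ t → farLength u t ≤ max (1 - a * t) (1 / 2)) {m : ℕ} (hm : m ≠ 0) :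
    ∫⁻ t in Set.Ioi (0 : ℝ), ENNReal.ofReal (farLength u t ^ m * t) ≤
      ENNReal.ofReal (1 / (a ^ 2 * ((m + 1) * (m + 2))) + (1 / 2) ^ m / 2) := by
  have hI : ∫ t in (0 : ℝ)..1, (max (1 - a * t) 0 ^ m * t + (1 / 2) ^ m * t) =
      1 / (a ^ 2 * ((m + 1) * (m + 2))) + (1 / 2) ^ m / 2 := by
    rw [intervalIntegral.integral_add (Continuous.intervalIntegrable (by fun_prop) _ _)
      (Continuous.intervalIntegrable (by fun_prop) _ _), integral_max_one_sub_mul_pow ha hm,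
      intervalIntegral.integral_const_mul, integral_id]
    ring
  have hint : IntegrableOn (fun t => max (1 - a * t) 0 ^ m * t + (1 / 2) ^ m * t)
      (Set.Ioc (0 : ℝ) 1) :=
    (intervalIntegrable_iff_integrableOn_Ioc_of_le zero_le_one).1
      (Continuous.intervalIntegrable (by fun_prop) _ _)
  rw [← hI, intervalIntegral.integral_of_le zero_le_one,
    ofReal_integral_eq_lintegral_ofReal hint ?_,
    ← lintegral_indicator measurableSet_Ioi, ← lintegral_indicator measurableSet_Ioc]
  · refine lintegral_mono fun t => ?_
    by_cases ht : t ∈ Set.Ioc (0 : ℝ) 1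
    · have ht0 : t ∈ Set.Ioi (0 : ℝ) := ht.1
      rw [Set.indicator_of_mem ht, Set.indicator_of_mem ht0]
      refine ENNReal.ofReal_le_ofReal ?_
      rw [← add_mul]
      refine mul_le_mul_of_nonneg_right ?_ ht.1.le
      refine (pow_le_pow_left₀ (farLength_nonneg u t) (h t ht.1.le) m).trans ?_
      rcases le_total (1 - a * t) (1 / 2) with h' | h'
      · rw [max_eq_right h']
        have : 0 ≤ max (1 - a * t) 0 ^ m := by positivity
        linarith
      · rw [max_eq_left h', max_eq_left (by linarith)]
        have : (0 : ℝ) ≤ (1 / 2) ^ m := by positivity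
        linarith
    · rw [Set.indicator_of_notMem ht]
      by_cases ht0 : t ∈ Set.Ioi (0 : ℝ)
      · rw [Set.indicator_of_mem ht0]
        have ht1 : 1 < t := by
          by_contra hc
          exact ht ⟨ht0, not_lt.1 hc⟩
        have : farLength u t = 0 := by
          rw [farLength, max_eq_right (by linarith [hu.2]), max_eq_right (by linarith [hu.1]),
            add_zero]
        simp [this, hm]
      · rw [Set.indicator_of_notMem ht0]
  · refine (ae_restrict_iff' measurableSet_Ioc).2 (Filter.Eventually.of_forall fun t ht => ?_)
    have := ht.1.le
    simp only [Pi.zero_apply]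
    positivity

/-- Expected squared half-distance from a fixed point to the nearest of `m` uniform points. -/
lemma integral_iInf_sq_le {x u a : ℝ} (hx : x = π / 2 * u) (hu : u ∈ Set.Icc (0 : ℝ) 1)
    (ha : 1 ≤ a) (h : ∀ t, 0 ≤ t → farLength u t ≤ max (1 - a * t) (1 / 2)) {m : ℕ}
    (hm : m ≠ 0) :
    ∫ y : Fin m → ℝ, (⨅ j : Fin m, ((x - y j) / 2) ^ 2) ∂(Measure.pi fun _ => uniformAngle) ≤
      π ^ 2 / 16 * (2 / (a ^ 2 * ((m + 1) * (m + 2))) + (1 / 2) ^ m) := by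
  have hpi := pi_pos
  have : Nonempty (Fin m) := ⟨⟨0, Nat.pos_of_ne_zero hm⟩⟩
  let f : (Fin m → ℝ) → ℝ := fun y => ⨅ j : Fin m, |π / 2 * u - y j| / (π / 2)
  have hf0 : ∀ y, 0 ≤ f y := fun y => Real.iInf_nonneg fun j => by positivity
  have hfm : Measurable f := Measurable.iInf fun j => by fun_prop
  have hbd : ∀ (y : Fin m → ℝ) (j : Fin m), BddBelow (Set.range fun j => ((x - y j) / 2) ^ 2) :=
    fun y j => (Set.finite_range _).bddBelow
  have hle : ∀ y : Fin m → ℝ,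
      (⨅ j : Fin m, ((x - y j) / 2) ^ 2) ≤ π ^ 2 / 16 * f y ^ (2 : ℝ) := by
    intro y
    obtain ⟨j, hj⟩ := exists_eq_ciInf_of_finite (f := fun j => |π / 2 * u - y j| / (π / 2))
    refine (ciInf_le (hbd y j) j).trans (le_of_eq ?_)
    change _ = π ^ 2 / 16 * (⨅ j : Fin m, |π / 2 * u - y j| / (π / 2)) ^ (2 : ℝ)
    rw [← hj, Real.rpow_two, div_pow |_|, sq_abs, hx]
    field_simp
    ring
  have htail : ∀ t, (Measure.pi fun _ : Fin m => uniformAngle) {y | t < f y} ≤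
      ENNReal.ofReal (farLength u t ^ m) := by
    intro t
    calc _ ≤ (Measure.pi fun _ : Fin m => uniformAngle)
          (Set.univ.pi fun _ => {v | t < |π / 2 * u - v| / (π / 2)}) := by
          refine measure_mono fun y hy j _ => ?_
          rw [Set.mem_ofPred_eq] at hy ⊢
          exact lt_of_lt_of_le hy (ciInf_le (Set.finite_range _).bddBelow j)
      _ = uniformAngle {v | t < |π / 2 * u - v| / (π / 2)} ^ m := by simp [Measure.pi_pi]
      _ ≤ _ := by
          rw [ENNReal.ofReal_pow (farLength_nonneg u t)]
          gcongr
          exact uniformAngle_far_le u t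
  have hlayer : ∫⁻ y, ENNReal.ofReal (f y ^ (2 : ℝ)) ∂(Measure.pi fun _ : Fin m => uniformAngle) ≤
      ENNReal.ofReal (2 / (a ^ 2 * ((m + 1) * (m + 2))) + (1 / 2) ^ m) := by
    rw [lintegral_rpow_eq_lintegral_meas_lt_mul _ (Filter.Eventually.of_forall hf0)
      hfm.aemeasurable two_pos]
    calc _ ≤ ENNReal.ofReal 2 *
          ∫⁻ t in Set.Ioi (0 : ℝ), ENNReal.ofReal (farLength u t ^ m * t) := by
          gcongr with t
          rw [ENNReal.ofReal_mul (pow_nonneg (farLength_nonneg u t) m),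
            show (2 : ℝ) - 1 = 1 by norm_num, Real.rpow_one]
          gcongr
          exact htail t
      _ ≤ _ := by
          refine (mul_le_mul_right (lintegral_farLength_pow_le hu ha h hm) _).trans ?_
          rw [← ENNReal.ofReal_mul zero_le_two]
          refine ENNReal.ofReal_le_ofReal (le_of_eq ?_)
          ring
  rw [integral_eq_lintegral_of_nonneg_ae
    (Filter.Eventually.of_forall fun y => Real.iInf_nonneg fun j => by positivity)
    (Measurable.iInf fun j => by fun_prop).aestronglyMeasurable]
  refine ENNReal.toReal_le_of_le_ofReal (by positivity) ?_
  calc _ ≤ ∫⁻ y, ENNReal.ofReal (π ^ 2 / 16) * ENNReal.ofReal (f y ^ (2 : ℝ))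
        ∂(Measure.pi fun _ : Fin m => uniformAngle) := by
        refine lintegral_mono fun y => ?_
        rw [← ENNReal.ofReal_mul (by positivity)]
        exact ENNReal.ofReal_le_ofReal (hle y)
    _ ≤ _ := by
        rw [lintegral_const_mul' _ _ ENNReal.ofReal_ne_top, ENNReal.ofReal_mul (by positivity)]
        gcongr

open ProbabilityTheory in
/-- Chebyshev's inequality for the number of independent samples landing in a set. -/
lemma pi_real_count_ge_le (ρ : Measure ℝ) [IsProbabilityMeasure ρ] {s : Set ℝ}
    (hs : MeasurableSet s) (m : ℕ) {c : ℝ} (hc : 0 < c) :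
    (Measure.pi fun _ : Fin m => ρ).real
      {y | m * ρ.real s + c ≤ ∑ j, s.indicator (fun _ => (1 : ℝ)) (y j)} ≤ m / 4 / c ^ 2 := by
  set μ := Measure.pi fun _ : Fin m => ρ
  let X : Fin m → (Fin m → ℝ) → ℝ := fun j y => s.indicator (fun _ => (1 : ℝ)) (y j)
  have hind : Measurable (s.indicator fun _ => (1 : ℝ)) := measurable_const.indicator hs
  have hXm : ∀ j, Measurable (X j) := fun j => hind.comp (measurable_pi_apply j)
  have hX01 : ∀ j y, X j y ∈ Set.Icc (0 : ℝ) 1 := fun j y => by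
    by_cases hy : y j ∈ s <;> simp [X, hy]
  have hL : ∀ j, MemLp (X j) 2 μ := fun j =>
    MemLp.of_bound (hXm j).aestronglyMeasurable 1 (Filter.Eventually.of_forall fun y => by
      rw [Real.norm_of_nonneg (hX01 j y).1]; exact (hX01 j y).2)
  have hindep : iIndepFun X μ :=
    iIndepFun_pi (X := fun _ => s.indicator fun _ => (1 : ℝ)) fun _ => hind.aemeasurable
  have hvar : variance (∑ j, X j) μ ≤ m / 4 := by
    rw [IndepFun.variance_sum (fun j _ => hL j) fun i _ j _ hij => hindep.indepFun hij]
    calc _ ≤ ∑ _j : Fin m, ((1 - 0 : ℝ) / 2) ^ 2 := Finset.sum_le_sum fun j _ =>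
          variance_le_sq_of_bounded (Filter.Eventually.of_forall (hX01 j)) (hXm j).aemeasurable
      _ = _ := by simp; ring
  have hmean : ∫ y, (∑ j, X j) y ∂μ = m * ρ.real s := by
    simp only [Finset.sum_apply]
    rw [integral_finsetSum _ fun j _ => (hL j).integrable one_le_two]
    have : ∀ j, ∫ y, X j y ∂μ = ρ.real s := fun j => by
      change ∫ y : Fin m → ℝ, s.indicator (fun _ => (1 : ℝ)) (y j) ∂μ = _
      rw [integral_comp_eval (μ := fun _ : Fin m => ρ) hind.aestronglyMeasurable,
        integral_indicator_const _ hs]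
      simp
    simp [this]
  have hcheb := meas_ge_le_variance_div_sq (memLp_finsetSum' Finset.univ fun j _ => hL j) hc
  rw [hmean] at hcheb
  refine ENNReal.toReal_le_of_le_ofReal (by positivity) ((measure_mono fun y hy => ?_).trans
    (hcheb.trans (ENNReal.ofReal_le_ofReal (by gcongr))))
  rw [Set.mem_ofPred_eq] at hy ⊢
  refine le_trans ?_ (le_abs_self _)
  rw [Finset.sum_apply]
  change _ ≤ ∑ j, s.indicator (fun _ => (1 : ℝ)) (y j) - _
  linarith

lemma card_le_sum_indicator {m : ℕ} (y : Fin m → ℝ) (s : Set ℝ) (t : Finset (Fin m))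
    (σ : Equiv.Perm (Fin m)) (h : ∀ i ∈ t, y (σ i) ∈ s) :
    (t.card : ℝ) ≤ ∑ j, s.indicator (fun _ => (1 : ℝ)) (y j) := by
  rw [← Equiv.sum_comp σ]
  calc (t.card : ℝ) = ∑ i ∈ t, s.indicator (fun _ => (1 : ℝ)) (y (σ i)) := by
        rw [Finset.sum_congr rfl fun i hi => Set.indicator_of_mem (h i hi) _]; simp
    _ ≤ _ := Finset.sum_le_sum_of_subset_of_nonneg (Finset.subset_univ _)
        fun i _ _ => Set.indicator_nonneg (fun _ _ => zero_le_one) _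

lemma add_one_le_sum_indicator_of_sort_lt {m : ℕ} (y : Fin m → ℝ) (k : Fin m) {c : ℝ}
    (h : y (Tuple.sort y k) < c) :
    (k : ℝ) + 1 ≤ ∑ j, (Set.Iio c).indicator (fun _ => (1 : ℝ)) (y j) := by
  have := card_le_sum_indicator y (Set.Iio c) (Finset.Iic k) (Tuple.sort y) fun i hi =>
    (Tuple.monotone_sort y (Finset.mem_Iic.1 hi)).trans_lt h
  simpa using this

lemma sub_le_sum_indicator_of_lt_sort {m : ℕ} (y : Fin m → ℝ) (k : Fin m) {c : ℝ}
    (h : c < y (Tuple.sort y k)) :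
    (m : ℝ) - k ≤ ∑ j, (Set.Ioi c).indicator (fun _ => (1 : ℝ)) (y j) := by
  have := card_le_sum_indicator y (Set.Ioi c) (Finset.Ici k) (Tuple.sort y) fun i hi =>
    h.trans_le (Tuple.monotone_sort y (Finset.mem_Ici.1 hi))
  rwa [Fin.card_Ici, Nat.cast_sub k.2.le] at this

lemma uniformAngle_real_Iio : uniformAngle.real (Set.Iio (π / 8)) ≤ 1 / 4 := by
  have hpi := pi_pos
  refine ENNReal.toReal_le_of_le_ofReal (by norm_num)
    ((uniformAngle_apply_of_inter_subset measurableSet_Iio (t := Set.Icc 0 (π / 8))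
      fun v hv => ⟨hv.2.1, hv.1.le⟩).trans (le_of_eq ?_))
  rw [Real.volume_Icc, ← ENNReal.ofReal_mul (by positivity)]
  congr 1
  field_simp
  ring

lemma uniformAngle_real_Ioi : uniformAngle.real (Set.Ioi (3 * π / 8)) ≤ 1 / 4 := by
  have hpi := pi_pos
  refine ENNReal.toReal_le_of_le_ofReal (by norm_num)
    ((uniformAngle_apply_of_inter_subset measurableSet_Ioi (t := Set.Icc (3 * π / 8) (π / 2))
      fun v hv => ⟨hv.1.le, hv.2.2⟩).trans (le_of_eq ?_))
  rw [Real.volume_Icc, ← ENNReal.ofReal_mul (by positivity)]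
  congr 1
  field_simp
  norm_num

lemma ten_mul_le_two_pow {m : ℕ} (hm : 100 ≤ m) : 10 * ((m + 1) * (m + 2)) ≤ 2 ^ m := by
  induction m, hm using Nat.le_induction with
  | base => norm_num
  | succ n hn ih => rw [pow_succ]; nlinarith

lemma farLength_le_one_sub {u : ℝ} (hu : u ∈ Set.Icc (0 : ℝ) 1) (t : ℝ) (ht : 0 ≤ t) :
    farLength u t ≤ max (1 - 1 * t) (1 / 2) := by
  obtain ⟨h0, h1⟩ := hu
  unfold farLength
  rcases max_cases (u - t) 0 with h | h <;> rcases max_cases (1 - u - t) 0 with h' | h' <;>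
    rcases max_cases (1 - 1 * t) (1 / 2) with h'' | h'' <;> linarith

lemma farLength_le_one_sub_two_mul {u : ℝ} (hu : u ∈ Set.Icc (1 / 4 : ℝ) (3 / 4)) (t : ℝ)
    (_ht : 0 ≤ t) : farLength u t ≤ max (1 - 2 * t) (1 / 2) := by
  obtain ⟨h0, h1⟩ := hu
  unfold farLength
  rcases max_cases (u - t) 0 with h | h <;> rcases max_cases (1 - u - t) 0 with h' | h' <;>
    rcases max_cases (1 - 2 * t) (1 / 2) with h'' | h'' <;> linarith

/-- The intermediate bound in the proof of Theorem 1: for `m ≥ 100` and `θ, θ̃` independent,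
each uniform on `[0, π/2]^m`, with `X(θ)` the `⌊m/2⌋`-th order statistic of `θ` (the value in
1-indexed position `⌊m/2⌋` when the coordinates are sorted in nondecreasing order),
`E[min_j ((X(θ) − θ̃_j)/2)²] ≤ 5π²/(64(m+1)(m+2))`. -/
theorem median_min_margin_bound (m : ℕ) (hm : 100 ≤ m) :
    (∫ θ : Fin m → ℝ, ∫ θt : Fin m → ℝ,
        (⨅ j : Fin m, ((θ (Tuple.sort θ ⟨m / 2 - 1, by omega⟩) - θt j) / 2) ^ 2)
        ∂(ENNReal.ofReal ((2 / π) ^ m) •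
            volume.restrict (Set.univ.pi fun _ : Fin m => Set.Icc (0 : ℝ) (π / 2)))
        ∂(ENNReal.ofReal ((2 / π) ^ m) •
            volume.restrict (Set.univ.pi fun _ : Fin m => Set.Icc (0 : ℝ) (π / 2))))
      ≤ 5 * π ^ 2 / (64 * ((m : ℝ) + 1) * ((m : ℝ) + 2)) := by
  have hpi := pi_pos
  rw [pi_uniformAngle]
  set μ := Measure.pi fun _ : Fin m => uniformAngle with hμ
  set k : Fin m := ⟨m / 2 - 1, by omega⟩ with hk
  have hm0 : m ≠ 0 := by omega
  have hmR : (100 : ℝ) ≤ m := by exact_mod_cast hm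
  have hk1 : ((m : ℝ) - 1) / 2 ≤ (k : ℝ) + 1 := by
    have : m ≤ 2 * ((k : ℕ) + 1) + 1 := by simp only [hk]; omega
    have : (m : ℝ) ≤ 2 * ((k : ℕ) + 1) + 1 := by exact_mod_cast this
    linarith
  have hk2 : ((m : ℝ) - 1) / 2 ≤ (m : ℝ) - k := by
    have : 2 * (k : ℕ) ≤ m := by simp only [hk]; omega
    have : 2 * ((k : ℕ) : ℝ) ≤ m := by exact_mod_cast this
    linarith
  set c : ℝ := (m : ℝ) / 4 - 1 / 2 with hc
  have hc0 : 0 < c := by linarith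
  let bad : Set ℝ → Set (Fin m → ℝ) := fun s =>
    {y | m * uniformAngle.real s + c ≤ ∑ j, s.indicator (fun _ => (1 : ℝ)) (y j)}
  have hbad : ∀ s, MeasurableSet s → μ.real (bad s) ≤ 1 / 20 := fun s hs => by
    refine (pi_real_count_ge_le uniformAngle hs m hc0).trans ?_
    rw [div_le_iff₀ (by positivity)]
    nlinarith
  have hbadm : ∀ s, MeasurableSet s → MeasurableSet (bad s) := fun s hs =>
    measurableSet_le measurable_const (Finset.measurable_sum _ fun j _ =>
      (measurable_const.indicator hs).comp (measurable_pi_apply j))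
  set B : Set (Fin m → ℝ) := bad (Set.Iio (π / 8)) ∪ bad (Set.Ioi (3 * π / 8)) with hB
  have hBm : MeasurableSet B := (hbadm _ measurableSet_Iio).union (hbadm _ measurableSet_Ioi)
  have hBle : μ.real B ≤ 1 / 10 := by
    have := measureReal_union_le (μ := μ) (bad (Set.Iio (π / 8))) (bad (Set.Ioi (3 * π / 8)))
    linarith [hbad _ (measurableSet_Iio (a := π / 8)), hbad _ (measurableSet_Ioi (a := 3 * π / 8))]
  have hgood : ∀ y : Fin m → ℝ, y ∉ B → y (Tuple.sort y k) ∈ Set.Icc (π / 8) (3 * π / 8) := by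
    intro y hy
    by_contra hcon
    refine hy ((Set.mem_union _ _ _).2 ?_)
    rw [Set.mem_Icc, not_and_or, not_le, not_le] at hcon
    rcases hcon with h | h
    · left
      have h1 := add_one_le_sum_indicator_of_sort_lt y k h
      have h2 := mul_le_mul_of_nonneg_left uniformAngle_real_Iio (Nat.cast_nonneg (α := ℝ) m)
      rw [Set.mem_ofPred_eq]
      linarith
    · right
      have h1 := sub_le_sum_indicator_of_lt_sort y k h
      have h2 := mul_le_mul_of_nonneg_left uniformAngle_real_Ioi (Nat.cast_nonneg (α := ℝ) m)
      rw [Set.mem_ofPred_eq]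
      linarith
  have hcube : ∀ᵐ y ∂μ, ∀ j, y j ∈ Set.Icc (0 : ℝ) (π / 2) := by
    rw [ae_all_iff]
    intro j
    refine (measurePreserving_eval (fun _ : Fin m => uniformAngle) j).quasiMeasurePreserving.ae
      (p := fun v => v ∈ Set.Icc (0 : ℝ) (π / 2)) ?_
    exact Measure.ae_smul_measure (ae_restrict_mem measurableSet_Icc) _
  set K : ℝ := ((m : ℝ) + 1) * (m + 2) with hK
  have hK0 : 0 < K := by positivity
  have hpow : (1 / 2 : ℝ) ^ m ≤ 1 / (10 * K) := by
    rw [one_div_pow]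
    refine one_div_le_one_div_of_le (by positivity) ?_
    rw [hK]
    exact_mod_cast ten_mul_le_two_pow hm
  have hbound : ∀ᵐ y ∂μ,
      (∫ z : Fin m → ℝ, (⨅ j : Fin m, ((y (Tuple.sort y k) - z j) / 2) ^ 2) ∂μ) ≤
        π ^ 2 / 16 * (3 / 5 / K) + B.indicator (fun _ => π ^ 2 / 16 * (21 / 10 / K)) y := by
    filter_upwards [hcube] with y hy
    set x := y (Tuple.sort y k) with hx
    have hxu : x = π / 2 * (x / (π / 2)) := by field_simp
    have hu : x / (π / 2) ∈ Set.Icc (0 : ℝ) 1 :=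
      ⟨div_nonneg (hy _).1 (by positivity), (div_le_one (by positivity)).2 (hy _).2⟩
    by_cases hyB : y ∈ B
    · rw [Set.indicator_of_mem hyB]
      refine (integral_iInf_sq_le hxu hu le_rfl (farLength_le_one_sub hu) hm0).trans ?_
      rw [← mul_add]
      refine mul_le_mul_of_nonneg_left ?_ (by positivity)
      calc _ ≤ 2 / (1 ^ 2 * K) + 1 / (10 * K) := by gcongr
        _ ≤ 3 / 5 / K + 21 / 10 / K := by
          have : 0 < 1 / K := by positivity
          have e : 3 / 5 / K + 21 / 10 / K - (2 / (1 ^ 2 * K) + 1 / (10 * K)) = 3 / 5 * (1 / K) := by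
            field_simp; norm_num
          linarith
    · rw [Set.indicator_of_notMem hyB, add_zero]
      obtain ⟨h1, h2⟩ := hgood y hyB
      have hu' : x / (π / 2) ∈ Set.Icc (1 / 4 : ℝ) (3 / 4) := by
        constructor
        · rw [le_div_iff₀ (by positivity)]; linarith
        · rw [div_le_iff₀ (by positivity)]; linarith
      refine (integral_iInf_sq_le hxu hu one_le_two (farLength_le_one_sub_two_mul hu')
        hm0).trans ?_
      refine mul_le_mul_of_nonneg_left ?_ (by positivity)
      calc _ ≤ 2 / (2 ^ 2 * K) + 1 / (10 * K) := by gcongr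
        _ = 3 / 5 / K := by field_simp; norm_num
  have hiB : Integrable (B.indicator fun _ => π ^ 2 / 16 * (21 / 10 / K)) μ :=
    (integrable_const _).indicator hBm
  calc _ ≤ ∫ y, (π ^ 2 / 16 * (3 / 5 / K) +
        B.indicator (fun _ => π ^ 2 / 16 * (21 / 10 / K)) y) ∂μ := by
        refine integral_mono_of_nonneg (Filter.Eventually.of_forall fun y =>
          integral_nonneg fun z => Real.iInf_nonneg fun j => by positivity)
          ((integrable_const _).add hiB) hbound
    _ = π ^ 2 / 16 * (3 / 5 / K) + μ.real B * (π ^ 2 / 16 * (21 / 10 / K)) := by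
        rw [integral_add (integrable_const _) hiB, integral_indicator_const _ hBm]
        simp
    _ ≤ π ^ 2 / 16 * (3 / 5 / K) + 1 / 10 * (π ^ 2 / 16 * (21 / 10 / K)) := by gcongr
    _ ≤ 5 / 4 * (π ^ 2 / 16 / K) := by
        have : 0 < π ^ 2 / 16 / K := by positivity
        have e : π ^ 2 / 16 * (3 / 5 / K) + 1 / 10 * (π ^ 2 / 16 * (21 / 10 / K)) =
          81 / 100 * (π ^ 2 / 16 / K) := by field_simp; norm_num
        linarith
    _ = _ := by rw [hK]; field_simp; norm_num
end

section
/- Let m ≥ 100 be an integer and let θ and θ̃ be independent, each uniformly distributed on [0, π/2]^m. Then E[ min_{1≤i,j≤m} ((θ_i − θ̃_j)/2)² ] ≤ 5 π² / (64 (m+1)(m+2)). (In the proof of Theorem 1 this upper-bounds min_{h∈ℋ} ℰ(h), the smallest expected squared bias over all bootstrap models, since the decision boundary of any bootstrap SVM has angle (θ_i − θ̃_j)/2 for some pair (i,j).) -/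
open MeasureTheory Real

/-- The uniform probability measure on `[0, π / 2]`. -/
noncomputable def uniformQuarterTurn : Measure ℝ :=
  ENNReal.ofReal (2 / π) • volume.restrict (Set.Icc (0 : ℝ) (π / 2))

instance : IsProbabilityMeasure uniformQuarterTurn := by
  constructor
  have := pi_pos
  simp only [uniformQuarterTurn, Measure.smul_apply, Measure.restrict_apply_univ,
    Real.volume_Icc, smul_eq_mul, sub_zero]
  rw [← ENNReal.ofReal_mul (by positivity), show 2 / π * (π / 2) = 1 by field_simp,
    ENNReal.ofReal_one]

theorem smul_restrict_pi_eq_pi_uniformQuarterTurn (m : ℕ) :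
    ENNReal.ofReal ((2 / π) ^ m) •
        volume.restrict (Set.univ.pi fun _ : Fin m => Set.Icc (0 : ℝ) (π / 2)) =
      Measure.pi fun _ : Fin m => uniformQuarterTurn := by
  refine (Measure.pi_eq fun s hs => ?_).symm
  rw [volume_pi, Measure.restrict_pi_pi]
  simp [uniformQuarterTurn, Measure.pi_pi, Finset.prod_mul_distrib,
    ENNReal.ofReal_pow (show (0 : ℝ) ≤ 2 / π by positivity)]

theorem ae_uniformQuarterTurn_mem_Icc :
    ∀ᵐ x ∂uniformQuarterTurn, x ∈ Set.Icc (0 : ℝ) (π / 2) :=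
  Measure.ae_smul_measure (ae_restrict_mem measurableSet_Icc) _

theorem uniformQuarterTurn_lt_abs_sub_le {x M t : ℝ} (hx : x ∈ Set.Icc 0 (π / 2))
    (hM : M = max x (π / 2 - x)) (ht : 0 ≤ t) (htM : t ≤ M) :
    uniformQuarterTurn {y | t < |x - y|} ≤ ENNReal.ofReal (1 - t / M) := by
  have hpi := pi_pos
  have hM0 : 0 < M := by 
    rw [hM, lt_max_iff]
    by_contra! h
    linarith [h.1, h.2]
  have hsub : {y | t < |x - y|} ∩ Set.Icc (0 : ℝ) (π / 2) ⊆
      Set.Icc 0 (x - t) ∪ Set.Icc (x + t) (π / 2) := by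
    rintro y ⟨hy, hy0, hy1⟩
    simp only [Set.mem_ofPred_eq, lt_abs] at hy
    rcases hy with hy | hy
    · left; constructor <;> linarith
    · right; constructor <;> linarith
  rw [uniformQuarterTurn, Measure.smul_apply, Measure.restrict_apply' measurableSet_Icc,
    smul_eq_mul]
  have h1 := (measure_mono (μ := volume) hsub).trans (measure_union_le _ _)
  rw [Real.volume_Icc, Real.volume_Icc] at h1
  have h2 : ENNReal.ofReal (x - t - 0) + ENNReal.ofReal (π / 2 - (x + t)) ≤
      ENNReal.ofReal (π / 2 * (1 - t / M)) := by
    have htm : t / M * M = t := by field_simp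
    have htm1 : t / M ≤ 1 := (div_le_one hM0).2 htM
    have htm0 : 0 ≤ t / M := by positivity
    have hxM : x ≤ M := hM ▸ le_max_left _ _
    have hxM' : π / 2 - x ≤ M := hM ▸ le_max_right _ _
    have hx0 : t / M * x ≤ t := by nlinarith
    have hx1 : t / M * (π / 2 - x) ≤ t := by nlinarith
    have hx2 := mul_nonneg hx.1 (sub_nonneg.2 htm1)
    have hx3 := mul_nonneg (sub_nonneg.2 hx.2) (sub_nonneg.2 htm1)
    rcases le_total (x - t) 0 with h | h
    · rw [ENNReal.ofReal_of_nonpos (by linarith), zero_add]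
      apply ENNReal.ofReal_le_ofReal
      nlinarith
    · rcases le_total (π / 2 - (x + t)) 0 with h' | h'
      · rw [ENNReal.ofReal_of_nonpos h', add_zero]
        apply ENNReal.ofReal_le_ofReal
        nlinarith
      · rw [← ENNReal.ofReal_add (by linarith) h']
        apply ENNReal.ofReal_le_ofReal
        nlinarith
  calc _ ≤ ENNReal.ofReal (2 / π) * ENNReal.ofReal (π / 2 * (1 - t / M)) := by
        gcongr; exact h1.trans h2
    _ = _ := by
      rw [← ENNReal.ofReal_mul (by positivity)]
      congr 1; field_simp

theorem integral_mul_one_sub_div_pow (m : ℕ) {M : ℝ} (hM : 0 < M) :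
    ∫ t in 0..M, (1 - t / M) ^ m * t = M ^ 2 / ((m + 1) * (m + 2)) := by
  have hd : ∀ t ∈ Set.uIcc 0 M, HasDerivAt (fun t : ℝ => -(t * M / (m + 1)) * (1 - t / M) ^ (m + 1)
      - M ^ 2 / ((m + 1) * (m + 2)) * (1 - t / M) ^ (m + 2)) ((1 - t / M) ^ m * t) t := by
    intro t _
    have h0 : HasDerivAt (fun t : ℝ => 1 - t / M) (-(1 / M)) t := by
      simpa using ((hasDerivAt_id t).div_const M).const_sub 1
    have h1 : HasDerivAt (fun t : ℝ => -(t * M / (m + 1))) (-(1 * M / (m + 1))) t :=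
      (((hasDerivAt_id t).mul_const M).div_const _).neg
    refine ((h1.mul (h0.pow (m + 1))).sub
      ((h0.pow (m + 2)).const_mul (M ^ 2 / ((m + 1) * (m + 2) : ℝ)))).congr_deriv ?_
    simp only [Pi.pow_apply, Nat.add_sub_cancel, show m + 2 - 1 = m + 1 by omega]
    push_cast
    have : (m : ℝ) + 1 ≠ 0 := by positivity
    have : (m : ℝ) + 2 ≠ 0 := by positivity
    have hM' : M * (1 - t / M) = M - t := by field_simp
    generalize 1 - t / M = u at *
    obtain rfl : t = M - M * u := by linarith
    field_simp
    ring
  rw [intervalIntegral.integral_eq_sub_of_hasDerivAt hd]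
  · simp [hM.ne']
  · apply Continuous.intervalIntegrable; fun_prop

theorem integral_max_sub_sq {L : ℝ} (hL : 0 ≤ L) :
    ∫ x in 0..L, (max x (L - x)) ^ 2 = 7 / 12 * L ^ 3 := by
  have hc : Continuous fun x : ℝ => (max x (L - x)) ^ 2 := by fun_prop
  rw [← intervalIntegral.integral_add_adjacent_intervals (b := L / 2)
    (hc.intervalIntegrable _ _) (hc.intervalIntegrable _ _)]
  have h1 : ∫ x in 0..L / 2, (max x (L - x)) ^ 2 = ∫ x in 0..L / 2, (L - x) ^ 2 := by
    refine intervalIntegral.integral_congr fun x hx => ?_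
    rw [Set.uIcc_of_le (by linarith)] at hx
    rw [max_eq_right (by linarith [hx.2])]
  have h2 : ∫ x in L / 2..L, (max x (L - x)) ^ 2 = ∫ x in L / 2..L, x ^ 2 := by
    refine intervalIntegral.integral_congr fun x hx => ?_
    rw [Set.uIcc_of_le (by linarith)] at hx
    rw [max_eq_left (by linarith [hx.1])]
  rw [h1, h2, intervalIntegral.integral_comp_sub_left (fun x => x ^ 2)]
  simp only [integral_pow]
  norm_num
  ring

theorem pi_uniformQuarterTurn_forall_lt_le {m : ℕ} {x M t : ℝ} (hx : x ∈ Set.Icc 0 (π / 2))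
    (hM : M = max x (π / 2 - x)) (ht : 0 ≤ t) (htM : t ≤ M) :
    (Measure.pi fun _ : Fin m => uniformQuarterTurn) {y | ∀ j, t < |x - y j|} ≤
      ENNReal.ofReal ((1 - t / M) ^ m) := by
  have hset : {y : Fin m → ℝ | ∀ j, t < |x - y j|} = Set.univ.pi fun _ => {y | t < |x - y|} := by
    ext y; simp
  rw [hset, Measure.pi_pi, Finset.prod_const, Finset.card_univ, Fintype.card_fin,
    ENNReal.ofReal_pow]
  · gcongr
    exact uniformQuarterTurn_lt_abs_sub_le hx hM ht htM
  · exact sub_nonneg.2 (div_le_one_of_le₀ htM (ht.trans htM))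

theorem integral_le_of_forall_le_sq {m : ℕ} [NeZero m] {x M : ℝ} {f : (Fin m → ℝ) → ℝ}
    (hf : Measurable f) (hf0 : 0 ≤ f) (hfx : ∀ y j, f y ≤ ((x - y j) / 2) ^ 2)
    (hx : x ∈ Set.Icc 0 (π / 2)) (hM : M = max x (π / 2 - x)) (hM0 : 0 < M) :
    ∫ y, f y ∂(Measure.pi fun _ : Fin m => uniformQuarterTurn) ≤
      M ^ 2 / (2 * ((m + 1) * (m + 2))) := by
  set ν := Measure.pi fun _ : Fin m => uniformQuarterTurn
  have hsub (t : ℝ) : {y | t < 2 * √(f y)} ⊆ {y | ∀ j, t < |x - y j|} := by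
    intro y hy j
    have h := Real.sqrt_le_sqrt (hfx y j)
    rw [Real.sqrt_sq_eq_abs, abs_div, abs_two] at h
    exact lt_of_lt_of_le (Set.mem_ofPred_eq ▸ hy) (by linarith)
  have hint : IntegrableOn (fun t => (1 - t / M) ^ m * (t / 2)) (Set.Ioc 0 M) :=
    (Continuous.integrableOn_Icc (by fun_prop)).mono_set Set.Ioc_subset_Icc_self
  rw [integral_eq_lintegral_of_nonneg_ae (ae_of_all _ hf0) hf.aestronglyMeasurable]
  refine ENNReal.toReal_le_of_le_ofReal (by positivity) ?_
  calc ∫⁻ y, ENNReal.ofReal (f y) ∂ν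
      = ∫⁻ y, ENNReal.ofReal (∫ t in 0..2 * √(f y), t / 2) ∂ν := by
        refine lintegral_congr fun y => ?_
        rw [intervalIntegral.integral_div, integral_id, mul_pow, Real.sq_sqrt (hf0 y)]
        congr 1
        ring
    _ = ∫⁻ t in Set.Ioi 0, ν {y | t < 2 * √(f y)} * ENNReal.ofReal (t / 2) := by
        refine lintegral_comp_eq_lintegral_meas_lt_mul ν (ae_of_all _ fun y => by positivity)
          (by fun_prop) (fun t _ => Continuous.intervalIntegrable (by fun_prop) _ _) ?_
        filter_upwards [ae_restrict_mem measurableSet_Ioi] with t ht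
        exact div_nonneg (le_of_lt ht) two_pos.le
    _ ≤ (∫⁻ t in Set.Ioc 0 M, ν {y | t < 2 * √(f y)} * ENNReal.ofReal (t / 2)) +
          ∫⁻ t in Set.Ioi M, ν {y | t < 2 * √(f y)} * ENNReal.ofReal (t / 2) := by
        rw [← Set.Ioc_union_Ioi_eq_Ioi hM0.le]
        exact lintegral_union_le _ _ _
    _ ≤ (∫⁻ t in Set.Ioc 0 M, ENNReal.ofReal ((1 - t / M) ^ m * (t / 2))) + 0 := by
        refine add_le_add (setLIntegral_mono (by fun_prop) fun t ht => ?_) (le_of_eq ?_)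
        · rw [ENNReal.ofReal_mul (pow_nonneg (sub_nonneg.2 (div_le_one_of_le₀ ht.2 hM0.le)) _)]
          gcongr
          exact (measure_mono (hsub t)).trans
            (pi_uniformQuarterTurn_forall_lt_le hx hM ht.1.le ht.2)
        · refine setLIntegral_eq_zero measurableSet_Ioi fun t ht => ?_
          have h : ν {y | t < 2 * √(f y)} ≤ 0 := by
            have hle := pi_uniformQuarterTurn_forall_lt_le (m := m) hx hM hM0.le le_rfl
            rw [div_self hM0.ne', sub_self, zero_pow (NeZero.ne m), ENNReal.ofReal_zero] at hle
            refine (measure_mono fun y hy j => ?_).trans hle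
            exact lt_trans ht (hsub t hy j)
          simp [nonpos_iff_eq_zero.1 h]
    _ = ENNReal.ofReal (∫ t in 0..M, (1 - t / M) ^ m * (t / 2)) := by
        rw [add_zero, intervalIntegral.integral_of_le hM0.le,
          ofReal_integral_eq_lintegral_ofReal hint]
        filter_upwards [ae_restrict_mem measurableSet_Ioc] with t ht
        exact mul_nonneg (pow_nonneg (sub_nonneg.2 (div_le_one_of_le₀ ht.2 hM0.le)) _)
          (div_nonneg ht.1.le two_pos.le)
    _ = ENNReal.ofReal (M ^ 2 / (2 * ((m + 1) * (m + 2)))) := by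
        simp_rw [← mul_div_assoc]
        rw [intervalIntegral.integral_div, integral_mul_one_sub_div_pow m hM0, div_div,
          mul_comm (2 : ℝ)]

theorem integral_max_sub_sq_uniformQuarterTurn :
    ∫ x, (max x (π / 2 - x)) ^ 2 ∂uniformQuarterTurn = 7 / 48 * π ^ 2 := by
  have := pi_pos
  rw [uniformQuarterTurn, integral_smul_measure, integral_Icc_eq_integral_Ioc,
    ← intervalIntegral.integral_of_le (by positivity), integral_max_sub_sq (by positivity),
    ENNReal.toReal_ofReal (by positivity), smul_eq_mul]
  field_simp
  norm_num


/-- The bound on `min_{h∈ℋ} ℰ(h)` in the proof of Theorem 1: for `m ≥ 100` and `θ, θ̃`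
independent, each uniform on `[0, π/2]^m`,
`E[min_{i,j} ((θ_i − θ̃_j)/2)²] ≤ 5π²/(64(m+1)(m+2))`. -/
theorem min_bootstrap_bias_bound (m : ℕ) (hm : 100 ≤ m) :
    (∫ θ : Fin m → ℝ, ∫ θt : Fin m → ℝ,
        (⨅ p : Fin m × Fin m, ((θ p.1 - θt p.2) / 2) ^ 2)
        ∂(ENNReal.ofReal ((2 / π) ^ m) •
            volume.restrict (Set.univ.pi fun _ : Fin m => Set.Icc (0 : ℝ) (π / 2)))
        ∂(ENNReal.ofReal ((2 / π) ^ m) •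
            volume.restrict (Set.univ.pi fun _ : Fin m => Set.Icc (0 : ℝ) (π / 2))))
      ≤ 5 * π ^ 2 / (64 * ((m : ℝ) + 1) * ((m : ℝ) + 2)) := by
  have : NeZero m := ⟨by omega⟩
  have hpi := pi_pos
  rw [smul_restrict_pi_eq_pi_uniformQuarterTurn]
  set ν := Measure.pi fun _ : Fin m => uniformQuarterTurn
  have hinf (θ θt : Fin m → ℝ) : 0 ≤ ⨅ p : Fin m × Fin m, ((θ p.1 - θt p.2) / 2) ^ 2 :=
    Real.iInf_nonneg fun p => sq_nonneg _
  have hmax : Integrable (fun x => (max x (π / 2 - x)) ^ 2) uniformQuarterTurn :=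
    not_imp_comm.1 integral_undef (by
      rw [integral_max_sub_sq_uniformQuarterTurn]
      positivity)
  calc _ ≤ ∫ θ : Fin m → ℝ, (max (θ 0) (π / 2 - θ 0)) ^ 2 / (2 * ((m + 1) * (m + 2))) ∂ν := by
        refine integral_mono_of_nonneg
          (ae_of_all _ fun θ => integral_nonneg fun θt => hinf θ θt) ?_ ?_
        · exact (integrable_comp_eval (X := fun _ : Fin m => ℝ) (μ := fun _ => uniformQuarterTurn)
            (i := 0) hmax).div_const _
        · filter_upwards [(measurePreserving_eval (fun _ : Fin m => uniformQuarterTurn)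
            0).quasiMeasurePreserving.ae ae_uniformQuarterTurn_mem_Icc] with θ hθ
          refine integral_le_of_forall_le_sq (x := θ 0) (Measurable.iInf fun p => by fun_prop)
            (hinf θ) (fun θt j => ?_) hθ rfl ?_
          · exact ciInf_le (Set.finite_range _).bddBelow ((0 : Fin m), j)
          · rw [lt_max_iff]
            by_contra! h
            linarith [h.1, h.2]
    _ = 7 / 48 * π ^ 2 / (2 * ((m + 1) * (m + 2))) := by
        rw [integral_div, integral_comp_eval (X := fun _ : Fin m => ℝ)
          (μ := fun _ => uniformQuarterTurn) (i := 0) (f := fun x => (max x (π / 2 - x)) ^ 2) hmax.aestronglyMeasurable,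
          integral_max_sub_sq_uniformQuarterTurn]
    _ ≤ _ := by
        rw [div_le_div_iff₀ (by positivity) (by positivity)]
        have : 0 ≤ π ^ 2 * (((m : ℝ) + 1) * (m + 2)) := by positivity
        linarith
end

section
/- Let m ≥ 20 be an integer and let ν_m be the uniform probability measure on [0, π/2]^m. Then ∫_{[0,π/2]^m} min_{1≤j≤m} (π/8 − θ_j)² dν_m(θ) ≤ 1.01 π² / (8 (m+1)(m+2)). (This is the rescaled form of Lemma 1 for i.i.d. uniforms on [0, π/2] with reference point π/8, used in the conditional step of the proof of Theorem 1.) -/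
open MeasureTheory Real

theorem integral_two_mul_mul_sub_two_mul_pow (a : ℝ) (m : ℕ) :
    ∫ t in (0 : ℝ)..a / 2, 2 * t * (a - 2 * t) ^ m = a ^ (m + 2) / (2 * (m + 1) * (m + 2)) := by
  have h1 : (m : ℝ) + 1 ≠ 0 := by positivity
  have h2 : (m : ℝ) + 2 ≠ 0 := by positivity
  rw [intervalIntegral.integral_eq_sub_of_hasDerivAt
    (f := fun t => -(1 / 2) * (a * ((a - 2 * t) ^ (m + 1) / (m + 1))
      - (a - 2 * t) ^ (m + 2) / (m + 2)))]
  · have : a - 2 * (a / 2) = 0 := by ring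
    simp only [this]
    simp
    field_simp
    ring
  · intro t _
    have hd : HasDerivAt (fun t : ℝ => a - 2 * t) (-2) t := by
      simpa using ((hasDerivAt_id t).const_mul 2).const_sub a
    refine (((((hd.pow (m + 1)).div_const ((m : ℝ) + 1)).const_mul a).sub
      ((hd.pow (m + 2)).div_const ((m : ℝ) + 2))).const_mul (-(1 / 2) : ℝ)).congr_deriv ?_
    push_cast
    field_simp
    ring
  · exact (by fun_prop : Continuous fun t : ℝ => 2 * t * (a - 2 * t) ^ m).intervalIntegrable _ _

theorem integral_two_mul_mul_sub_pow (b c : ℝ) (m : ℕ) :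
    ∫ t in c..b, 2 * t * (b - t) ^ m =
      2 * b * ((b - c) ^ (m + 1) / (m + 1)) - 2 * ((b - c) ^ (m + 2) / (m + 2)) := by
  have h1 : (m : ℝ) + 1 ≠ 0 := by positivity
  have h2 : (m : ℝ) + 2 ≠ 0 := by positivity
  rw [intervalIntegral.integral_eq_sub_of_hasDerivAt
    (f := fun t => -(2 * b * ((b - t) ^ (m + 1) / (m + 1)) - 2 * ((b - t) ^ (m + 2) / (m + 2))))]
  · simp
  · intro t _
    have hd : HasDerivAt (fun t : ℝ => b - t) (-1) t := by
      simpa using (hasDerivAt_id t).const_sub b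
    refine ((((hd.pow (m + 1)).div_const ((m : ℝ) + 1)).const_mul (2 * b)).sub
      (((hd.pow (m + 2)).div_const ((m : ℝ) + 2)).const_mul 2)).neg.congr_deriv ?_
    push_cast
    field_simp
    ring
  · exact (by fun_prop : Continuous fun t : ℝ => 2 * t * (b - t) ^ m).intervalIntegrable _ _

theorem setLIntegral_ofReal_eq_ofReal_intervalIntegral {f : ℝ → ℝ} (hf : Continuous f) {a b : ℝ}
    (hab : a ≤ b) (h : ∀ t ∈ Set.Ioc a b, 0 ≤ f t) :
    ∫⁻ t in Set.Ioc a b, ENNReal.ofReal (f t) = ENNReal.ofReal (∫ t in a..b, f t) := by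
  rw [intervalIntegral.integral_of_le hab, ofReal_integral_eq_lintegral_ofReal]
  · exact (hf.intervalIntegrable a b).1
  · exact (ae_restrict_iff' measurableSet_Ioc).2 (Filter.Eventually.of_forall h)

/-- The part of `[0, a + b]` at distance more than `t` from `a`. -/
theorem volume_Icc_inter_lt_abs_sub_le (a b t : ℝ) :
    volume {x ∈ Set.Icc 0 (a + b) | t < |a - x|} ≤
      ENNReal.ofReal (a - t) + ENNReal.ofReal (b - t) := by
  calc volume {x ∈ Set.Icc 0 (a + b) | t < |a - x|}
      ≤ volume (Set.Icc 0 (a - t) ∪ Set.Icc (a + t) (a + b)) := by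
        refine measure_mono fun x hx => ?_
        obtain ⟨⟨h0, h1⟩, h2⟩ := hx
        rcases lt_abs.1 h2 with h | h
        · exact Or.inl ⟨h0, by linarith⟩
        · exact Or.inr ⟨by linarith, h1⟩
    _ ≤ _ := measure_union_le _ _
    _ = _ := by
        rw [Real.volume_Icc, Real.volume_Icc]
        congr 2 <;> ring

theorem ofReal_sub_add_ofReal_sub_pow_le {a b : ℝ} (hab : a ≤ b) (t : ℝ) {m : ℕ} (hm : m ≠ 0) :
    (ENNReal.ofReal (a - t) + ENNReal.ofReal (b - t)) ^ m ≤
      (Set.Iic ((a + b) / 2)).indicator (fun t => ENNReal.ofReal ((a + b - 2 * t) ^ m)) t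
      + (Set.Ioc a b).indicator (fun t => ENNReal.ofReal ((b - t) ^ m)) t := by
  rcases le_or_gt t a with h | h
  · refine le_add_right ?_
    rw [Set.indicator_of_mem (Set.mem_Iic.2 (by linarith)),
      ← ENNReal.ofReal_add (by linarith) (by linarith), ← ENNReal.ofReal_pow (by linarith)]
    exact le_of_eq (by ring_nf)
  · rw [ENNReal.ofReal_of_nonpos (by linarith : a - t ≤ 0), zero_add]
    rcases le_or_gt t b with h' | h'
    · refine le_add_left ?_
      rw [Set.indicator_of_mem (Set.mem_Ioc.2 ⟨h, h'⟩), ENNReal.ofReal_pow (by linarith)]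
    · rw [ENNReal.ofReal_of_nonpos (by linarith : b - t ≤ 0), zero_pow hm]
      exact zero_le

theorem lintegral_tail_mul_le {a b : ℝ} (ha : 0 ≤ a) (hab : a ≤ b) {m : ℕ} (hm : m ≠ 0) :
    ∫⁻ t in Set.Ioi (0 : ℝ),
        (ENNReal.ofReal (a - t) + ENNReal.ofReal (b - t)) ^ m * ENNReal.ofReal (2 * t) ≤
      ENNReal.ofReal ((a + b) ^ (m + 2) / (2 * (m + 1) * (m + 2))) +
      ENNReal.ofReal (2 * b * ((b - a) ^ (m + 1) / (m + 1)) -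
        2 * ((b - a) ^ (m + 2) / (m + 2))) := by
  rw [← integral_two_mul_mul_sub_two_mul_pow, ← integral_two_mul_mul_sub_pow,
    ← setLIntegral_ofReal_eq_ofReal_intervalIntegral (by fun_prop) (by linarith),
    ← setLIntegral_ofReal_eq_ofReal_intervalIntegral (by fun_prop) hab,
    ← lintegral_indicator measurableSet_Ioc, ← lintegral_indicator measurableSet_Ioc,
    ← lintegral_indicator measurableSet_Ioi, ← lintegral_add_left]
  · refine lintegral_mono fun t => ?_
    by_cases ht : 0 < t
    · rw [Set.indicator_of_mem (Set.mem_Ioi.2 ht)]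
      refine (mul_le_mul_left (ofReal_sub_add_ofReal_sub_pow_le hab t hm) _).trans ?_
      rw [add_mul]
      have h2t : 0 ≤ 2 * t := by linarith
      refine add_le_add ?_ ?_
      · by_cases h : t ≤ (a + b) / 2
        · rw [Set.indicator_of_mem (Set.mem_Iic.2 h), Set.indicator_of_mem (Set.mem_Ioc.2 ⟨ht, h⟩),
            ENNReal.ofReal_mul h2t, mul_comm]
        · rw [Set.indicator_of_notMem (by simpa using h), zero_mul]
          exact zero_le
      · by_cases h : t ∈ Set.Ioc a b
        · rw [Set.indicator_of_mem h, Set.indicator_of_mem h, ENNReal.ofReal_mul h2t, mul_comm]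
        · rw [Set.indicator_of_notMem h, zero_mul]
          exact zero_le
    · rw [Set.indicator_of_notMem (by simpa using ht)]
      exact zero_le
  · exact Measurable.indicator (by fun_prop) measurableSet_Ioc
  · intro t ht
    exact mul_nonneg (by linarith [ht.1]) (pow_nonneg (by linarith [ht.2]) m)
  · intro t ht
    exact mul_nonneg (by linarith [ht.1]) (pow_nonneg (by linarith [ht.2]) m)

theorem volume_restrict_pi_lt_sqrt_iInf_le (a b : ℝ) (m : ℕ) {t : ℝ} (ht : 0 ≤ t) :
    volume.restrict (Set.univ.pi fun _ : Fin m => Set.Icc (0 : ℝ) (a + b))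
        {θ | t < √(⨅ j : Fin m, (a - θ j) ^ 2)} ≤
      (ENNReal.ofReal (a - t) + ENNReal.ofReal (b - t)) ^ m := by
  rw [Measure.restrict_apply' (MeasurableSet.univ_pi fun _ => measurableSet_Icc)]
  calc _ ≤ volume (Set.univ.pi fun _ : Fin m => {x ∈ Set.Icc 0 (a + b) | t < |a - x|}) := by
        refine measure_mono fun θ hθ j _ => ⟨hθ.2 j trivial, ?_⟩
        have h : t ^ 2 < (a - θ j) ^ 2 :=
          ((Real.lt_sqrt ht).1 hθ.1).trans_le
            (ciInf_le (Set.finite_range fun j => (a - θ j) ^ 2).bddBelow j)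
        rw [← abs_of_nonneg ht]
        exact sq_lt_sq.1 h
    _ = volume {x ∈ Set.Icc 0 (a + b) | t < |a - x|} ^ m := by
        rw [volume_pi_pi]
        simp
    _ ≤ _ := by
        gcongr
        exact volume_Icc_inter_lt_abs_sub_le a b t

theorem measurable_iInf_sub_sq (a : ℝ) (m : ℕ) :
    Measurable fun θ : Fin m → ℝ => ⨅ j : Fin m, (a - θ j) ^ 2 :=
  Measurable.iInf fun j => by fun_prop

theorem lintegral_iInf_sub_sq_le {a b : ℝ} (ha : 0 ≤ a) (hab : a ≤ b) {m : ℕ} (hm : m ≠ 0) :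
    ∫⁻ θ in Set.univ.pi fun _ : Fin m => Set.Icc (0 : ℝ) (a + b),
        ENNReal.ofReal (⨅ j : Fin m, (a - θ j) ^ 2) ≤
      ENNReal.ofReal ((a + b) ^ (m + 2) / (2 * (m + 1) * (m + 2))) +
      ENNReal.ofReal (2 * b * ((b - a) ^ (m + 1) / (m + 1)) -
        2 * ((b - a) ^ (m + 2) / (m + 2))) := by
  have hsq : ∀ θ : Fin m → ℝ, ⨅ j : Fin m, (a - θ j) ^ 2 =
      √(⨅ j : Fin m, (a - θ j) ^ 2) ^ (2 : ℝ) := fun θ => by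
    rw [Real.rpow_two, Real.sq_sqrt (Real.iInf_nonneg fun j => sq_nonneg _)]
  rw [lintegral_congr fun θ => congrArg ENNReal.ofReal (hsq θ),
    lintegral_rpow_eq_lintegral_meas_lt_mul _
      (Filter.Eventually.of_forall fun θ => Real.sqrt_nonneg _)
      (measurable_iInf_sub_sq a m).sqrt.aemeasurable two_pos,
    ← lintegral_const_mul' _ _ ENNReal.ofReal_ne_top]
  refine le_trans (setLIntegral_mono' measurableSet_Ioi fun t ht => ?_)
    (lintegral_tail_mul_le ha hab hm)
  rw [mul_left_comm, ← ENNReal.ofReal_mul zero_le_two, show (2 : ℝ) - 1 = 1 by norm_num,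
    Real.rpow_one]
  gcongr
  exact volume_restrict_pi_lt_sqrt_iInf_le a b m (le_of_lt ht)

theorem add_four_mul_half_pow_le {m : ℕ} (hm : 20 ≤ m) :
    ((m : ℝ) + 4) * (1 / 2) ^ m ≤ 0.02 := by
  induction m, hm using Nat.le_induction with
  | base => norm_num
  | succ n _ ih =>
    have : (0 : ℝ) < (1 / 2) ^ n := by positivity
    push_cast
    rw [pow_succ]
    nlinarith

/-- The rescaled form of Lemma 1 for i.i.d. uniforms on `[0, π/2]` with reference point `π/8`:
for `m ≥ 20`, `E[min_j (π/8 − θ_j)²] ≤ 1.01 π² / (8(m+1)(m+2))`. -/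
theorem min_margin_lemma1_rescaled (m : ℕ) (hm : 20 ≤ m) :
    ∫ θ : Fin m → ℝ, (⨅ j : Fin m, (π / 8 - θ j) ^ 2)
        ∂(ENNReal.ofReal ((2 / π) ^ m) •
            volume.restrict (Set.univ.pi fun _ : Fin m => Set.Icc (0 : ℝ) (π / 2)))
      ≤ 1.01 * π ^ 2 / (8 * ((m : ℝ) + 1) * ((m : ℝ) + 2)) := by
  have hm0 : m ≠ 0 := by omega
  have hπ := pi_pos
  have hmain := lintegral_iInf_sub_sq_le (a := π / 8) (b := 3 * π / 8) (by positivity)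
    (by linarith) hm0
  rw [show π / 8 + 3 * π / 8 = π / 2 by ring, show 3 * π / 8 - π / 8 = π / 4 by ring] at hmain
  have hsecond : 2 * (3 * π / 8) * ((π / 4) ^ (m + 1) / (m + 1)) -
      2 * ((π / 4) ^ (m + 2) / (m + 2)) =
      (π / 2) ^ m * (π ^ 2 / 16 * (((m : ℝ) + 4) * (1 / 2) ^ m) / ((m + 1) * (m + 2))) := by
    rw [show π / 4 = π / 2 * (1 / 2) by ring]
    simp only [pow_add, mul_pow]
    field_simp
    ring
  have hfirst : (π / 2) ^ (m + 2) / (2 * ((m : ℝ) + 1) * (m + 2)) =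
      (π / 2) ^ m * (π ^ 2 / 8 / ((m + 1) * (m + 2))) := by
    rw [pow_add]
    field_simp
    ring
  rw [hsecond, hfirst, ← ENNReal.ofReal_add (by positivity) (by positivity)] at hmain
  rw [integral_eq_lintegral_of_nonneg_ae
    (Filter.Eventually.of_forall fun θ => Real.iInf_nonneg fun j => sq_nonneg _)
    (measurable_iInf_sub_sq _ m).aestronglyMeasurable, lintegral_smul_measure, smul_eq_mul]
  refine ENNReal.toReal_le_of_le_ofReal (by positivity) ((mul_le_mul_right hmain _).trans ?_)
  rw [← ENNReal.ofReal_mul (by positivity), ← mul_add, ← mul_assoc, ← mul_pow,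
    show 2 / π * (π / 2) = 1 by field_simp, one_pow, one_mul, ← add_div]
  refine ENNReal.ofReal_le_ofReal ?_
  calc _ ≤ (π ^ 2 / 8 + π ^ 2 / 16 * 0.02) / (((m : ℝ) + 1) * (m + 2)) := by
        gcongr
        exact add_four_mul_half_pow_le hm
    _ = _ := by
        field_simp
        norm_num
end

section
/- Let m be a positive integer, let μ_m be the uniform probability measure on [0,1]^m, and let x ∈ [0,1]. Then ∫_{[0,1]^m} min_{1≤j≤m} (x − θ_j)² dμ_m(θ) ≤ ∫_{[0,1]^m} min_{1≤j≤m} θ_j² dμ_m(θ). (That is, among all reference points x ∈ [0,1], the expected squared distance from x to the nearest of m i.i.d. uniform points is maximized at the endpoint x = 0; this stochastic-domination fact underlies the bound on the 'bad' conditioning event in the proof of Theorem 1, where min_j((X − θ̃_j)/2)² is bounded via min_j θ̃_j².) -/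
open MeasureTheory

/-- Among the points of `[0,1]`, the endpoint `0` is the one from which a uniform point is most
likely to be at squared distance at least `t`. -/
lemma volume_restrict_Icc_le_sq_dist_le {x : ℝ} (hx : x ∈ Set.Icc (0 : ℝ) 1) {t : ℝ}
    (ht : 0 ≤ t) :
    (volume.restrict (Set.Icc (0 : ℝ) 1)) {u | t ≤ (x - u) ^ 2}
      ≤ (volume.restrict (Set.Icc (0 : ℝ) 1)) {u | t ≤ u ^ 2} := by
  obtain ⟨s, hs, rfl⟩ : ∃ s : ℝ, 0 ≤ s ∧ s ^ 2 = t :=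
    ⟨√t, Real.sqrt_nonneg t, Real.sq_sqrt ht⟩
  obtain ⟨hx0, hx1⟩ := hx
  rw [Measure.restrict_apply' measurableSet_Icc, Measure.restrict_apply' measurableSet_Icc]
  calc volume ({u | s ^ 2 ≤ (x - u) ^ 2} ∩ Set.Icc (0 : ℝ) 1)
      ≤ volume (Set.Icc 0 (x - s) ∪ Set.Icc (x + s) 1) := by
        refine measure_mono ?_
        rintro u ⟨hu, hu0, hu1⟩
        have hu' : s ≤ |x - u| := by
          simpa [abs_of_nonneg hs] using sq_le_sq.mp (Set.mem_ofPred.mp hu)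
        rcases le_abs.mp hu' with h | h
        · exact Or.inl ⟨hu0, by linarith⟩
        · exact Or.inr ⟨by linarith, hu1⟩
    _ ≤ volume (Set.Icc 0 (x - s)) + volume (Set.Icc (x + s) 1) := measure_union_le _ _
    _ ≤ volume (Set.Icc s 1) := by
        simp only [Real.volume_Icc]
        rcases le_total (x - s) 0 with h | h
        · rw [ENNReal.ofReal_of_nonpos (by linarith), zero_add]
          exact ENNReal.ofReal_le_ofReal (by linarith)
        · rcases le_total (1 - (x + s)) 0 with h' | h'
          · rw [ENNReal.ofReal_of_nonpos h', add_zero]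
            exact ENNReal.ofReal_le_ofReal (by linarith)
          · rw [← ENNReal.ofReal_add (by linarith) h']
            exact ENNReal.ofReal_le_ofReal (by linarith)
    _ ≤ volume ({u | s ^ 2 ≤ u ^ 2} ∩ Set.Icc (0 : ℝ) 1) := by
        refine measure_mono ?_
        rintro u ⟨hu, hu1⟩
        exact ⟨pow_le_pow_left₀ hs hu 2, hs.trans hu, hu1⟩

lemma pi_setOf_le_iInf {ι : Type*} [Fintype ι] [Nonempty ι] (ν : Measure ℝ) [SigmaFinite ν]
    (f : ℝ → ℝ) (t : ℝ) :
    (Measure.pi fun _ : ι => ν) {θ | t ≤ ⨅ j, f (θ j)} = ∏ _j : ι, ν {u | t ≤ f u} := by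
  rw [← Measure.pi_pi]
  congr 1
  ext θ
  simp [le_ciInf_iff (Set.finite_range fun j => f (θ j)).bddBelow]

/-- Among all reference points `x ∈ [0,1]`, the expected squared distance from `x` to the
nearest of `m` i.i.d. uniform points on `[0,1]` is maximized at the endpoint `x = 0`:
`E[min_j (x − θ_j)²] ≤ E[min_j θ_j²]`. -/
theorem min_sq_dist_maximized_at_endpoint (m : ℕ) (hm : 0 < m) (x : ℝ)
    (hx : x ∈ Set.Icc (0 : ℝ) 1) :
    ∫ θ : Fin m → ℝ, (⨅ j : Fin m, (x - θ j) ^ 2)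
        ∂(volume.restrict (Set.univ.pi fun _ : Fin m => Set.Icc (0 : ℝ) 1))
      ≤ ∫ θ : Fin m → ℝ, (⨅ j : Fin m, (θ j) ^ 2)
          ∂(volume.restrict (Set.univ.pi fun _ : Fin m => Set.Icc (0 : ℝ) 1)) := by
  have : Nonempty (Fin m) := ⟨⟨0, hm⟩⟩
  have hmeas : Measurable fun θ : Fin m → ℝ => ⨅ j, (x - θ j) ^ 2 :=
    Measurable.iInf fun j => by fun_prop
  have hmeas₀ : Measurable fun θ : Fin m → ℝ => ⨅ j, (θ j) ^ 2 :=
    Measurable.iInf fun j => by fun_prop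
  have hnn (θ : Fin m → ℝ) : 0 ≤ ⨅ j, (x - θ j) ^ 2 :=
    Real.iInf_nonneg fun j => sq_nonneg _
  have hnn₀ (θ : Fin m → ℝ) : 0 ≤ ⨅ j, (θ j) ^ 2 := Real.iInf_nonneg fun j => sq_nonneg _
  rw [volume_pi, Measure.restrict_pi_pi,
    integral_eq_lintegral_of_nonneg_ae (.of_forall (hnn)) hmeas.aestronglyMeasurable,
    integral_eq_lintegral_of_nonneg_ae (.of_forall hnn₀) hmeas₀.aestronglyMeasurable]
  refine ENNReal.toReal_mono ?_ ?_
  · refine ((lintegral_mono_ae (g := fun _ => 1) ?_).trans_lt (by simp)).ne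
    rw [← Measure.restrict_pi_pi]
    filter_upwards [ae_restrict_mem (MeasurableSet.univ_pi fun _ => measurableSet_Icc)] with θ hθ
    obtain ⟨h0, h1⟩ := hθ ⟨0, hm⟩ trivial
    exact ENNReal.ofReal_le_one.mpr <|
      (ciInf_le (Set.finite_range _).bddBelow ⟨0, hm⟩).trans (pow_le_one₀ h0 h1)
  · rw [lintegral_eq_lintegral_meas_le _ (.of_forall (hnn)) hmeas.aemeasurable,
      lintegral_eq_lintegral_meas_le _ (.of_forall hnn₀) hmeas₀.aemeasurable]
    refine setLIntegral_mono' measurableSet_Ioi fun t ht => ?_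
    rw [pi_setOf_le_iInf _ fun u => (x - u) ^ 2, pi_setOf_le_iInf _ fun u => u ^ 2]
    exact Finset.prod_le_prod' fun _ _ => volume_restrict_Icc_le_sq_dist_le hx (Set.mem_Ioi.mp ht).le
end
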